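/- Let G be an infinite commutative group. The uppermost mean M* is an upper mean on G, the lowest mean M_* is its conjugate lower mean (M_*(f) = −M*(−f)), and they are extremal: for every upper mean M̄ and every bounded f : G → ℝ, M̄(f) ≤ M*(f), and for every lower mean M̲ and every bounded f, M̲(f) ≥ M_*(f). -/

import Mathlib

open scoped Pointwise BigOperators
open Filter

/-- A real function on `G` is bounded. -/
def Bounded {G : Type*} (f : G → ℝ) : Prop :=
  ∃ C : ℝ, ∀ x, |f x| ≤ C

/-- An upper mean on the bounded real functions on a commutative group `G`. -/
structure IsUpperMean (G : Type*) [AddCommGroup G] (M : (G → ℝ) → ℝ) : Prop where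
  norming : ∀ c : ℝ, M (fun _ => c) = c
  mono : ∀ f g : G → ℝ, Bounded f → Bounded g → (∀ x, f x ≤ g x) → M f ≤ M g
  homog : ∀ c : ℝ, 0 ≤ c → ∀ f : G → ℝ, Bounded f → M (fun x => c * f x) = c * M f
  restr_add : ∀ f : G → ℝ, Bounded f → ∀ t : G, M (fun x => f x + f (x + t)) = 2 * M f
  subadd : ∀ f g : G → ℝ, Bounded f → Bounded g → M (fun x => f x + g x) ≤ M f + M g

/-- A lower mean on the bounded real functions on a commutative group `G`. -/
structure IsLowerMean (G : Type*) [AddCommGroup G] (M : (G → ℝ) → ℝ) : Prop where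
  norming : ∀ c : ℝ, M (fun _ => c) = c
  mono : ∀ f g : G → ℝ, Bounded f → Bounded g → (∀ x, f x ≤ g x) → M f ≤ M g
  homog : ∀ c : ℝ, 0 ≤ c → ∀ f : G → ℝ, Bounded f → M (fun x => c * f x) = c * M f
  restr_add : ∀ f : G → ℝ, Bounded f → ∀ t : G, M (fun x => f x + f (x + t)) = 2 * M f
  superadd : ∀ f g : G → ℝ, Bounded f → Bounded g → M f + M g ≤ M (fun x => f x + g x)

/-- `f` and `f'` are commarginal: marginals of a bounded `F` supported near the diagonal. -/
def Commarginal {G : Type*} [AddCommGroup G] (f f' : G → ℝ) : Prop :=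
  ∃ (F : G → G → ℝ) (B : Finset G),
    (∃ C : ℝ, ∀ x y, |F x y| ≤ C) ∧
    (∀ x y, F x y ≠ 0 → x - y ∈ B) ∧
    (∀ x, ∑ᶠ y, F x y = f x) ∧
    (∀ y, ∑ᶠ x, F x y = f' y)

/-- Uniform convergence of a sequence of functions. -/
def UnifLim {G : Type*} (g : ℕ → G → ℝ) (f : G → ℝ) : Prop :=
  ∀ ε : ℝ, 0 < ε → ∃ N : ℕ, ∀ n ≥ N, ∀ x, |g n x - f x| < ε

/-- `f` and `f'` are limit-commarginal. -/
def LimitCommarginal {G : Type*} [AddCommGroup G] (f f' : G → ℝ) : Prop :=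
  ∃ g g' : ℕ → G → ℝ, (∀ n, Bounded (g n)) ∧ (∀ n, Bounded (g' n)) ∧
    (∀ n, Commarginal (g n) (g' n)) ∧ UnifLim g f ∧ UnifLim g' f'

/-- `g` is a finite convex combination of translates of `f`. -/
def ConvexCombTranslates {G : Type*} [AddCommGroup G] (f g : G → ℝ) : Prop :=
  ∃ (n : ℕ) (c : Fin n → ℝ) (t : Fin n → G),
    (∀ i, 0 ≤ c i) ∧ (∑ i, c i) = 1 ∧ ∀ x, g x = ∑ i, c i * f (x + t i)

/-- The uppermost mean `M*`. -/
noncomputable def Mstar {G : Type*} [AddCommGroup G] (f : G → ℝ) : ℝ :=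
  sInf {a : ℝ | ∃ g : G → ℝ, ConvexCombTranslates f g ∧ a = sSup (Set.range g)}

/-- The lowest mean `M_*`. -/
noncomputable def Mlowstar {G : Type*} [AddCommGroup G] (f : G → ℝ) : ℝ :=
  sSup {a : ℝ | ∃ g : G → ℝ, ConvexCombTranslates f g ∧ a = sInf (Set.range g)}

/-- The `B`-average `(f|B)(t)` of `f`. -/
noncomputable def avg {G : Type*} [AddCommGroup G] (f : G → ℝ) (B : Finset G) (t : G) : ℝ :=
  (∑ b ∈ B, f (b + t)) / (B.card : ℝ)

/-- The expansion pseudomean `E(f)`. -/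
noncomputable def Epm {G : Type*} [AddCommGroup G] [DecidableEq G] (f : G → ℝ) : ℝ :=
  ⨅ T : {T : Finset G // T.Nonempty}, ⨆ B : {B : Finset G // B.Nonempty},
    (∑ b ∈ B.1, f b) / (((B.1 + T.1).card : ℝ))

/-- A finite nonempty `Y ⊆ G` is a tile: some set `Z` of translates partitions `G`. -/
def IsTile {G : Type*} [AddCommGroup G] (Y : Finset G) : Prop :=
  Y.Nonempty ∧ ∃ Z : Set G, ∀ x : G, ∃! p : Y × Z, (p.1 : G) + (p.2 : G) = x

section Boundedness

variable {G : Type*} {f g : G → ℝ}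

lemma Bounded.neg (hf : Bounded f) : Bounded (fun x => -f x) := by
  obtain ⟨C, hC⟩ := hf
  exact ⟨C, fun x => by simpa using hC x⟩

lemma Bounded.add (hf : Bounded f) (hg : Bounded g) : Bounded (fun x => f x + g x) := by
  obtain ⟨C, hC⟩ := hf
  obtain ⟨D, hD⟩ := hg
  exact ⟨C + D, fun x => (abs_add_le _ _).trans (add_le_add (hC x) (hD x))⟩

lemma Bounded.const_mul (hf : Bounded f) (c : ℝ) : Bounded (fun x => c * f x) := by
  obtain ⟨C, hC⟩ := hf
  exact ⟨|c| * C, fun x => by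
    rw [abs_mul]
    exact mul_le_mul_of_nonneg_left (hC x) (abs_nonneg c)⟩

lemma Bounded.const (c : ℝ) : Bounded (fun _ : G => c) := ⟨|c|, fun _ => le_rfl⟩

lemma Bounded.sum {ι : Type*} (s : Finset ι) {F : ι → G → ℝ} (hF : ∀ i, Bounded (F i)) :
    Bounded (fun x => ∑ i ∈ s, F i x) := by
  choose C hC using hF
  exact ⟨∑ i ∈ s, C i, fun x =>
    (Finset.abs_sum_le_sum_abs _ _).trans (Finset.sum_le_sum fun i _ => hC i x)⟩

lemma Bounded.translate [AddCommGroup G] (hf : Bounded f) (t : G) :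
    Bounded (fun x => f (x + t)) := by
  obtain ⟨C, hC⟩ := hf
  exact ⟨C, fun x => hC (x + t)⟩

end Boundedness

section ConvexCombinations

variable {G : Type*} [AddCommGroup G] {f g h : G → ℝ}

lemma ConvexCombTranslates.of_fintype {ι : Type*} [Fintype ι] {c : ι → ℝ} {t : ι → G}
    (hc : ∀ i, 0 ≤ c i) (hs : ∑ i, c i = 1) (hg : ∀ x, g x = ∑ i, c i * f (x + t i)) :
    ConvexCombTranslates f g := by
  let e := Fintype.equivFin ι
  refine ⟨Fintype.card ι, c ∘ e.symm, t ∘ e.symm, fun i => hc _, ?_, fun x => ?_⟩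
  · rw [← hs]
    exact Equiv.sum_comp e.symm c
  · rw [hg]
    exact (Equiv.sum_comp e.symm fun i => c i * f (x + t i)).symm

lemma ConvexCombTranslates.refl (f : G → ℝ) : ConvexCombTranslates f f :=
  .of_fintype (ι := Unit) (c := fun _ => 1) (t := fun _ => 0) (by simp) (by simp) (by simp)

lemma ConvexCombTranslates.trans (hfg : ConvexCombTranslates f g)
    (hgh : ConvexCombTranslates g h) : ConvexCombTranslates f h := by
  obtain ⟨n, c, t, hc, hcs, hg⟩ := hfg
  obtain ⟨m, d, r, hd, hds, hh⟩ := hgh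
  refine .of_fintype (ι := Fin m × Fin n) (c := fun p => d p.1 * c p.2)
    (t := fun p => r p.1 + t p.2) (fun p => mul_nonneg (hd _) (hc _)) ?_ fun x => ?_
  · rw [Fintype.sum_prod_type]
    simp [← Finset.mul_sum, hcs, hds]
  · rw [Fintype.sum_prod_type, hh]
    simp [hg, Finset.mul_sum, mul_assoc, add_assoc]

lemma ConvexCombTranslates.const_mul (hfg : ConvexCombTranslates f g) (a : ℝ) :
    ConvexCombTranslates (fun x => a * f x) (fun x => a * g x) := by
  obtain ⟨n, c, t, hc, hcs, hg⟩ := hfg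
  refine ⟨n, c, t, hc, hcs, fun x => ?_⟩
  simp only [hg, Finset.mul_sum]
  exact Finset.sum_congr rfl fun i _ => by ring

lemma ConvexCombTranslates.neg (hfg : ConvexCombTranslates f g) :
    ConvexCombTranslates (fun x => -f x) (fun x => -g x) := by
  simpa using hfg.const_mul (-1)

lemma ConvexCombTranslates.translate (hfg : ConvexCombTranslates f g) (s : G) :
    ConvexCombTranslates (fun x => f (x + s)) (fun x => g (x + s)) := by
  obtain ⟨n, c, t, hc, hcs, hg⟩ := hfg
  refine ⟨n, c, t, hc, hcs, fun x => ?_⟩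
  simp only [hg]
  exact Finset.sum_congr rfl fun i _ => by rw [add_right_comm]

lemma convexCombTranslates_half_add_translate (f : G → ℝ) (t : G) :
    ConvexCombTranslates f (fun x => 2⁻¹ * (f x + f (x + t))) :=
  ⟨2, ![2⁻¹, 2⁻¹], ![0, t], by simp [Fin.forall_fin_two], by norm_num [Fin.sum_univ_two],
    fun x => by simp [Fin.sum_univ_two, mul_add]⟩

lemma sum_mul_le_of_forall_le {n : ℕ} {c a : Fin n → ℝ} {s : ℝ} (hc : ∀ i, 0 ≤ c i)
    (hcs : ∑ i, c i = 1) (ha : ∀ i, a i ≤ s) : ∑ i, c i * a i ≤ s :=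
  calc ∑ i, c i * a i ≤ ∑ i, c i * s :=
        Finset.sum_le_sum fun i _ => mul_le_mul_of_nonneg_left (ha i) (hc i)
    _ = s := by rw [← Finset.sum_mul, hcs, one_mul]

lemma ConvexCombTranslates.abs_le {C : ℝ} (hfg : ConvexCombTranslates f g)
    (hf : ∀ x, |f x| ≤ C) (x : G) : |g x| ≤ C := by
  obtain ⟨n, c, t, hc, hcs, hg⟩ := hfg
  rw [hg]
  refine (Finset.abs_sum_le_sum_abs _ _).trans ?_
  simp only [abs_mul, abs_of_nonneg (hc _)]
  exact sum_mul_le_of_forall_le hc hcs fun i => hf _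

end ConvexCombinations

section UppermostMean

variable {G : Type*} [AddCommGroup G] {f g : G → ℝ}

lemma Mstar_le {a : ℝ} (hf : Bounded f) (hfg : ConvexCombTranslates f g)
    (ha : ∀ x, g x ≤ a) : Mstar f ≤ a := by
  obtain ⟨C, hC⟩ := hf
  refine le_trans (csInf_le ⟨-C, ?_⟩ ⟨g, hfg, rfl⟩) (ciSup_le ha)
  rintro _ ⟨h, hh, rfl⟩
  have hb := hh.abs_le hC
  exact (abs_le.1 (hb 0)).1.trans
    (le_ciSup (f := h) ⟨C, by rintro _ ⟨x, rfl⟩; exact (abs_le.1 (hb x)).2⟩ 0)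

lemma le_Mstar {a : ℝ} (hf : Bounded f)
    (h : ∀ g, ConvexCombTranslates f g → ∀ s, (∀ x, g x ≤ s) → a ≤ s) : a ≤ Mstar f := by
  obtain ⟨C, hC⟩ := hf
  refine le_csInf ⟨_, f, .refl f, rfl⟩ ?_
  rintro _ ⟨g, hg, rfl⟩
  exact h g hg _ fun x =>
    le_ciSup (f := g) ⟨C, by rintro _ ⟨y, rfl⟩; exact (abs_le.1 (hg.abs_le hC y)).2⟩ x

lemma Mstar_const (c : ℝ) : Mstar (fun _ : G => c) = c := by
  refine le_antisymm (Mstar_le (.const c) (.refl _) fun _ => le_rfl)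
    (le_Mstar (.const c) fun g hg s hs => ?_)
  obtain ⟨n, d, t, hd, hds, hg⟩ := hg
  have h := hs 0
  rwa [hg, ← Finset.sum_mul, hds, one_mul] at h

lemma Mstar_mono (hf : Bounded f) (hg : Bounded g) (hfg : ∀ x, f x ≤ g x) :
    Mstar f ≤ Mstar g := by
  refine le_Mstar hg fun h hh s hs => ?_
  obtain ⟨n, c, t, hc, hcs, hh⟩ := hh
  refine Mstar_le hf (g := fun x => ∑ i, c i * f (x + t i)) ⟨n, c, t, hc, hcs, fun _ => rfl⟩
    fun x => le_trans ?_ (hs x)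
  rw [hh]
  exact Finset.sum_le_sum fun i _ => mul_le_mul_of_nonneg_left (hfg _) (hc i)

lemma Mstar_const_mul_le {c : ℝ} (hc : 0 < c) (hf : Bounded f) :
    Mstar (fun x => c * f x) ≤ c * Mstar f := by
  rw [← div_le_iff₀' hc]
  refine le_Mstar hf fun g hg s hs => ?_
  rw [div_le_iff₀' hc]
  exact Mstar_le (hf.const_mul c) (hg.const_mul c) fun x =>
    mul_le_mul_of_nonneg_left (hs x) hc.le

lemma Mstar_const_mul {c : ℝ} (hc : 0 ≤ c) (hf : Bounded f) :
    Mstar (fun x => c * f x) = c * Mstar f := by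
  obtain rfl | hc := hc.eq_or_lt
  · simpa using Mstar_const (G := G) 0
  refine le_antisymm (Mstar_const_mul_le hc hf) ?_
  have h := Mstar_const_mul_le (inv_pos.2 hc) (hf.const_mul c)
  simp only [inv_mul_cancel_left₀ hc.ne'] at h
  rwa [← div_eq_inv_mul, le_div_iff₀' hc] at h

lemma Mstar_add_le (hf : Bounded f) (hg : Bounded g) :
    Mstar (fun x => f x + g x) ≤ Mstar f + Mstar g := by
  rw [← sub_le_iff_le_add']
  refine le_Mstar hg fun v hv r hr => ?_
  rw [sub_le_comm]
  refine le_Mstar hf fun u hu s hs => ?_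
  rw [sub_le_iff_le_add]
  obtain ⟨n, c, t, hc, hcs, hu⟩ := hu
  obtain ⟨m, d, q, hd, hds, hv⟩ := hv
  have hw : ConvexCombTranslates (fun x => f x + g x)
      (fun x => ∑ j, d j * ∑ i, c i * (f (x + q j + t i) + g (x + q j + t i))) :=
    .trans (g := fun x => ∑ i, c i * (f (x + t i) + g (x + t i)))
      ⟨n, c, t, hc, hcs, fun _ => rfl⟩ ⟨m, d, q, hd, hds, fun _ => rfl⟩
  refine Mstar_le (hf.add hg) hw fun x => ?_
  have key : ∑ j, d j * ∑ i, c i * (f (x + q j + t i) + g (x + q j + t i)) =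
      ∑ j, d j * u (x + q j) + ∑ i, c i * v (x + t i) := by
    simp only [hu, hv, mul_add, Finset.sum_add_distrib, Finset.mul_sum]
    congr 1
    rw [Finset.sum_comm]
    exact Finset.sum_congr rfl fun i _ => Finset.sum_congr rfl fun j _ => by
      rw [add_right_comm, mul_left_comm]
  rw [key]
  exact add_le_add (sum_mul_le_of_forall_le hd hds fun j => hs _)
    (sum_mul_le_of_forall_le hc hcs fun i => hr _)

lemma Mstar_translate_le (hf : Bounded f) (t : G) :
    Mstar (fun x => f (x + t)) ≤ Mstar f :=
  le_Mstar hf fun _ hg _ hs => Mstar_le (hf.translate t) (hg.translate t) fun _ => hs _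

lemma Mstar_add_translate (hf : Bounded f) (t : G) :
    Mstar (fun x => f x + f (x + t)) = 2 * Mstar f := by
  refine le_antisymm ?_ (le_Mstar (hf.add (hf.translate t)) fun g hg s hs => ?_)
  · linarith [Mstar_add_le hf (hf.translate t), Mstar_translate_le hf t]
  · have h := Mstar_le hf
      ((convexCombTranslates_half_add_translate f t).trans (hg.const_mul 2⁻¹))
      (a := 2⁻¹ * s) fun x => mul_le_mul_of_nonneg_left (hs x) (by norm_num)
    linarith

lemma isUpperMean_Mstar : IsUpperMean G (Mstar (G := G)) where
  norming := Mstar_const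
  mono _ _ := Mstar_mono
  homog _ hc _ := Mstar_const_mul hc
  restr_add _ := Mstar_add_translate
  subadd _ _ := Mstar_add_le

lemma Mlowstar_eq_neg_Mstar_neg (f : G → ℝ) : Mlowstar f = -Mstar (fun x => -f x) := by
  rw [Mlowstar, Mstar, Real.sInf_def, neg_neg]
  congr 1
  ext a
  rw [Set.mem_neg]
  constructor
  · rintro ⟨g, hg, rfl⟩
    refine ⟨_, hg.neg, ?_⟩
    rw [Real.sInf_def, neg_neg]
    congr 1
    ext y
    simp [neg_eq_iff_eq_neg, eq_neg_iff_add_eq_zero, add_comm]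
  · rintro ⟨g, hg, ha⟩
    refine ⟨fun x => -g x, by simpa using hg.neg, ?_⟩
    rw [Real.sInf_def, ← neg_eq_iff_eq_neg, ha]
    congr 1
    ext y
    simp

end UppermostMean

section Extremality

variable {G : Type*} [AddCommGroup G] {M : (G → ℝ) → ℝ} {f g : G → ℝ}

lemma IsUpperMean.le_of_forall_le (hM : IsUpperMean G M) (hf : Bounded f) {a : ℝ}
    (ha : ∀ x, f x ≤ a) : M f ≤ a :=
  (hM.mono f _ hf (.const a) ha).trans_eq (hM.norming a)

lemma IsUpperMean.sub_translate_two_pow (hM : IsUpperMean G M) (hf : Bounded f) (t : G) (k : ℕ) :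
    M (fun x => f x + -f (x + 2 ^ k • t)) = 2 ^ k * M (fun x => f x + -f (x + t)) := by
  induction k with
  | zero => simp
  | succ k ih =>
    rw [pow_succ' (2 : ℝ), mul_assoc, ← ih,
      ← hM.restr_add _ (hf.add (hf.translate _).neg) (2 ^ k • t)]
    congr 1
    ext x
    rw [pow_succ, mul_two, add_smul, ← add_assoc]
    ring

lemma IsUpperMean.sub_translate_le_zero (hM : IsUpperMean G M) (hf : Bounded f) (t : G) :
    M (fun x => f x + -f (x + t)) ≤ 0 := by
  obtain ⟨C, hC⟩ := id hf
  by_contra! hpos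
  obtain ⟨k, hk⟩ := pow_unbounded_of_one_lt
    ((C + C) / M (fun x => f x + -f (x + t))) (one_lt_two (α := ℝ))
  rw [div_lt_iff₀ hpos, ← hM.sub_translate_two_pow hf t k] at hk
  refine hk.not_ge (hM.le_of_forall_le (hf.add (hf.translate _).neg) fun x => ?_)
  linarith [(abs_le.1 (hC x)).2, (abs_le.1 (hC (x + 2 ^ k • t))).1]

lemma IsUpperMean.sum_le {ι : Type*} (hM : IsUpperMean G M) (s : Finset ι) {F : ι → G → ℝ}
    (hF : ∀ i, Bounded (F i)) : M (fun x => ∑ i ∈ s, F i x) ≤ ∑ i ∈ s, M (F i) := by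
  classical
  induction s using Finset.induction_on with
  | empty => simpa using (hM.norming 0).le
  | insert i s hi ih =>
    simp only [Finset.sum_insert hi]
    exact (hM.subadd _ _ (hF i) (.sum s hF)).trans (by gcongr)

lemma IsUpperMean.le_convexComb (hM : IsUpperMean G M) (hf : Bounded f)
    (hfg : ConvexCombTranslates f g) : M f ≤ M g := by
  obtain ⟨C, hC⟩ := id hf
  have hg' : Bounded g := ⟨C, hfg.abs_le hC⟩
  obtain ⟨n, c, t, hc, hcs, hg⟩ := hfg
  have hb : ∀ i, Bounded (fun x => f x + -f (x + t i)) := fun i => hf.add (hf.translate _).neg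
  have hsum : M (fun x => ∑ i, c i * (f x + -f (x + t i))) ≤ 0 := by
    refine (hM.sum_le _ fun i => (hb i).const_mul (c i)).trans
      (Finset.sum_nonpos fun i _ => ?_)
    rw [hM.homog _ (hc i) _ (hb i)]
    exact mul_nonpos_of_nonneg_of_nonpos (hc i) (hM.sub_translate_le_zero hf _)
  have hdecomp : f = fun x => g x + ∑ i, c i * (f x + -f (x + t i)) := by
    ext x
    simp only [mul_add, Finset.sum_add_distrib, ← Finset.sum_mul, hcs, hg, mul_neg,
      Finset.sum_neg_distrib]
    ring
  calc M f = M (fun x => g x + ∑ i, c i * (f x + -f (x + t i))) := congrArg M hdecomp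
    _ ≤ M g + M (fun x => ∑ i, c i * (f x + -f (x + t i))) :=
        hM.subadd _ _ hg' (.sum _ fun i => (hb i).const_mul (c i))
    _ ≤ M g := by linarith

lemma IsUpperMean.le_Mstar (hM : IsUpperMean G M) (hf : Bounded f) : M f ≤ Mstar f := by
  obtain ⟨C, hC⟩ := id hf
  exact _root_.le_Mstar hf fun g hg s hs =>
    (hM.le_convexComb hf hg).trans (hM.le_of_forall_le ⟨C, hg.abs_le hC⟩ hs)

lemma IsLowerMean.isUpperMean_neg (hM : IsLowerMean G M) :
    IsUpperMean G (fun f => -M (fun x => -f x)) where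
  norming c := by rw [hM.norming, neg_neg]
  mono f g hf hg hfg := neg_le_neg (hM.mono _ _ hg.neg hf.neg fun x => neg_le_neg (hfg x))
  homog c hc f hf := by
    have h := hM.homog c hc _ hf.neg
    simp only [mul_neg] at h ⊢
    rw [h]
  restr_add f hf t := by
    have h := hM.restr_add _ hf.neg t
    simp only [← neg_add] at h
    rw [h, mul_neg]
  subadd f g hf hg := by
    have h := hM.superadd _ _ hf.neg hg.neg
    simp only [← neg_add] at h
    linarith

lemma IsLowerMean.Mlowstar_le (hM : IsLowerMean G M) (hf : Bounded f) : Mlowstar f ≤ M f := by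
  have h := hM.isUpperMean_neg.le_Mstar hf.neg
  simp only [neg_neg] at h
  rw [Mlowstar_eq_neg_Mstar_neg]
  linarith

end Extremality

/-- `M*` is an upper mean, `M_*` is its conjugate lower mean, and they are
extremal among upper and lower means. -/
theorem stmt9 {G : Type*} [AddCommGroup G] [Infinite G] :
    IsUpperMean G (Mstar (G := G)) ∧
    (∀ f : G → ℝ, Bounded f → Mlowstar f = -Mstar (fun x => -f x)) ∧
    (∀ M : (G → ℝ) → ℝ, IsUpperMean G M → ∀ f : G → ℝ, Bounded f → M f ≤ Mstar f) ∧
    (∀ M : (G → ℝ) → ℝ, IsLowerMean G M → ∀ f : G → ℝ, Bounded f → Mlowstar f ≤ M f) :=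
  ⟨isUpperMean_Mstar, fun f _ => Mlowstar_eq_neg_Mstar_neg f, fun _ hM _ hf => hM.le_Mstar hf,
    fun _ hM _ hf => hM.Mlowstar_le hf⟩
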